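/- arXiv:1612.07974 — 2 statements merged into one kernel-verified Lean document; each statement's English description precedes it below -/
import Mathlib

section
/- The function space decomposition identity: for the pure polyanalytic kernels K_{δ;n,r}, the full kernel satisfies K_{n,q}(z,w) = ∑_{r=0}^{q-1} \frac{n^{-r}}{r!} T_{n,z}^r \overline{T_{n,w}^r} K_n(z,w), where T_n acts in the variable indicated and T_{n,z}^r \overline{T_{n,w}^r} K_n(z,w) means apply (T_n)^r in z and the conjugate operator in w. Equivalently, if (e_j)_{j=0}^{n-1} is an orthonormal basis of Pol_{n,1} in L^2(μ_n), then the functions \frac{n^{-r/2}}{\sqrt{r!}} T_n^r e_j for 0 ≤ j ≤ n-1, 0 ≤ r ≤ q-1 form an orthonormal basis of Pol_{n,q}. -/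
open MeasureTheory Real

/-- Wirtinger derivative `∂ = (∂_x - i ∂_y)/2`. -/
noncomputable def wD (f : ℂ → ℂ) (z : ℂ) : ℂ :=
  (fderiv ℝ f z 1 - Complex.I * fderiv ℝ f z Complex.I) / 2

/-- The raising operator `T_n f(z) = n z̄ f(z) - ∂f(z)`. -/
noncomputable def Tn (n : ℝ) (f : ℂ → ℂ) (z : ℂ) : ℂ :=
  (n : ℂ) * (starRingEnd ℂ) z * f z - wD f z

/-- `Pol_{n,q} = span{ z̄^r z^j : j < n, r < q }`. -/
noncomputable def Pol (n q : ℕ) : Submodule ℂ (ℂ → ℂ) :=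
  Submodule.span ℂ
    {f | ∃ j < n, ∃ r < q, f = fun z => ((starRingEnd ℂ) z) ^ r * z ^ j}

/-- Normalized inner product in `L²(e^{-n|z|²} dA)`, with `dA = dxdy/π`. -/
noncomputable def fockInner (n : ℕ) (f g : ℂ → ℂ) : ℂ :=
  (∫ z : ℂ, f z * (starRingEnd ℂ) (g z) * (Real.exp (-(n : ℝ) * ‖z‖ ^ 2) : ℂ)) / (π : ℂ)

abbrev MP := MvPolynomial (Fin 2) ℂ

noncomputable def evp (p : MP) (z : ℂ) : ℂ :=
  MvPolynomial.eval ![z, (starRingEnd ℂ) z] p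

lemma evp_add (p q : MP) (z : ℂ) : evp (p + q) z = evp p z + evp q z := by simp [evp]
lemma evp_sub (p q : MP) (z : ℂ) : evp (p - q) z = evp p z - evp q z := by simp [evp]
lemma evp_mul (p q : MP) (z : ℂ) : evp (p * q) z = evp p z * evp q z := by simp [evp]
lemma evp_C (a : ℂ) (z : ℂ) : evp (MvPolynomial.C a) z = a := by simp [evp]
lemma evp_smul (a : ℂ) (p : MP) (z : ℂ) : evp (a • p) z = a * evp p z := by simp [evp]
lemma evp_X0 (z : ℂ) : evp (MvPolynomial.X 0) z = z := by simp [evp]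
lemma evp_X1 (z : ℂ) : evp (MvPolynomial.X 1) z = (starRingEnd ℂ) z := by simp [evp]
lemma evp_pow (p : MP) (k : ℕ) (z : ℂ) : evp (p ^ k) z = evp p z ^ k := by simp [evp]

noncomputable def evL : MP →ₗ[ℂ] (ℂ → ℂ) where
  toFun := evp
  map_add' p q := by ext z; simp [evp_add]
  map_smul' a p := by ext z; simp [evp_smul]

noncomputable def cL (a b : ℂ) : ℂ →L[ℝ] ℂ :=
  a • (ContinuousLinearMap.id ℝ ℂ) + b • (Complex.conjCLE : ℂ →L[ℝ] ℂ)

lemma cL_apply (a b v : ℂ) : cL a b v = a * v + b * (starRingEnd ℂ) v := by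
  simp [cL]

lemma hasF_congr {f g : ℂ → ℂ} {f' g' : ℂ →L[ℝ] ℂ} {z : ℂ} (h : HasFDerivAt f f' z)
    (hfg : ∀ w, g w = f w) (hd : ∀ v, g' v = f' v) : HasFDerivAt g g' z := by
  obtain rfl : g = f := funext hfg
  obtain rfl : g' = f' := ContinuousLinearMap.ext hd
  exact h

lemma conj_hasFDerivAt (z : ℂ) :
    HasFDerivAt (fun w : ℂ => (starRingEnd ℂ) w) (cL 0 1) z :=
  hasF_congr ((Complex.conjCLE : ℂ →L[ℝ] ℂ).hasFDerivAt (x := z)) (fun w => by simp)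
    (fun v => by simp [cL_apply])

lemma evp_hasFDerivAt (p : MP) (z : ℂ) :
    HasFDerivAt (evp p) (cL (evp (MvPolynomial.pderiv 0 p) z) (evp (MvPolynomial.pderiv 1 p) z)) z := by
  induction p using MvPolynomial.induction_on with
  | C a =>
    exact hasF_congr (hasFDerivAt_const (𝕜 := ℝ) a z) (fun w => by simp [evp_C])
      (fun v => by simp [cL_apply, evp])
  | add p q hp hq =>
    exact hasF_congr (hp.add hq) (fun w => by simp [evp_add])
      (fun v => by simp [cL_apply, evp]; ring)
  | mul_X p i hp =>
    fin_cases i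
    · exact hasF_congr (hp.mul (hasFDerivAt_id (𝕜 := ℝ) z)) (fun w => by simp [evp])
        (fun v => by simp [cL_apply, evp, MvPolynomial.pderiv_mul]; ring)
    · exact hasF_congr (hp.mul (conj_hasFDerivAt z)) (fun w => by simp [evp])
        (fun v => by simp [cL_apply, evp, MvPolynomial.pderiv_mul]; ring)

lemma wD_evp (p : MP) : wD (evp p) = evp (MvPolynomial.pderiv 0 p) := by
  ext z
  rw [wD, (evp_hasFDerivAt p z).fderiv, cL_apply, cL_apply]
  simp only [map_one, Complex.conj_I]
  ring_nf
  simp only [Complex.I_sq]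
  ring

noncomputable def TP (n : ℕ) : MP →ₗ[ℂ] MP :=
  (n : ℂ) • LinearMap.mulLeft ℂ (MvPolynomial.X 1) - (MvPolynomial.pderiv 0).toLinearMap

lemma TP_apply (n : ℕ) (p : MP) :
    TP n p = (n : ℂ) • (MvPolynomial.X 1 * p) - MvPolynomial.pderiv 0 p := by
  simp [TP]

lemma Tn_evp (n : ℕ) (p : MP) : Tn (n : ℝ) (evp p) = evp (TP n p) := by
  ext z
  rw [Tn, wD_evp, TP_apply, evp_sub, evp_smul, evp_mul, evp_X1]
  push_cast
  ring

lemma Tn_iter (n r : ℕ) (p : MP) : (Tn (n : ℝ))^[r] (evp p) = evp ((TP n)^[r] p) := by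
  induction r with
  | zero => rfl
  | succ r ih => rw [Function.iterate_succ_apply', Function.iterate_succ_apply', ih, Tn_evp]

noncomputable def wt (n : ℕ) (z : ℂ) : ℂ := (Real.exp (-(n : ℝ) * ‖z‖ ^ 2) : ℂ)

lemma wt_eq (n : ℕ) (z : ℂ) : wt n z = Complex.exp (-(n : ℂ) * (z * (starRingEnd ℂ) z)) := by
  rw [wt, Complex.mul_conj, Complex.normSq_eq_norm_sq]
  push_cast
  rfl

lemma wt_hasFDerivAt (n : ℕ) (z : ℂ) :
    HasFDerivAt (wt n) (cL (-(n : ℂ) * (starRingEnd ℂ) z * wt n z) (-(n : ℂ) * z * wt n z)) z := by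
  have h := ((((hasFDerivAt_id (𝕜 := ℝ) z).mul (conj_hasFDerivAt z)).const_mul (-(n : ℂ)))).cexp
  exact hasF_congr h (fun w => by simp [wt_eq]) (fun v => by simp [cL_apply, wt_eq]; ring)

lemma integrable_pow (n : ℕ) (hn : 1 ≤ n) (k : ℕ) :
    Integrable (fun z : ℂ => ‖z‖ ^ k * Real.exp (-(n : ℝ) * ‖z‖ ^ 2)) := by
  have hn' : (0 : ℝ) < n := by exact_mod_cast hn
  have h := Complex.integral_rpow_mul_exp_neg_mul_rpow (p := 2) (q := k) (b := n) (by norm_num)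
    (by have : (0 : ℝ) ≤ k := by positivity
        linarith) hn'
  have h2 : Integrable (fun z : ℂ => ‖z‖ ^ (k : ℝ) * Real.exp (-(n : ℝ) * ‖z‖ ^ (2 : ℝ))) := by
    apply Integrable.of_integral_ne_zero
    rw [h]
    have : 0 < Real.Gamma (((k : ℝ) + 2) / 2) := Real.Gamma_pos_of_pos (by positivity)
    positivity
  convert h2 using 4 with z
  · simp
  · simp

lemma evp_cont (p : MP) : Continuous (evp p) :=
  continuous_iff_continuousAt.2 fun z => (evp_hasFDerivAt p z).continuousAt

lemma wt_cont (n : ℕ) : Continuous (wt n) :=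
  continuous_iff_continuousAt.2 fun z => (wt_hasFDerivAt n z).continuousAt

lemma evp_integrable (n : ℕ) (hn : 1 ≤ n) (p : MP) :
    Integrable (fun z : ℂ => evp p z * wt n z) := by
  induction p using MvPolynomial.induction_on' with
  | monomial s a =>
    have h := (integrable_pow n hn (s 0 + s 1)).const_mul ‖a‖
    refine h.mono' ((evp_cont _).mul (wt_cont n)).aestronglyMeasurable (Filter.Eventually.of_forall fun z => ?_)
    have : evp (MvPolynomial.monomial s a) z = a * (z ^ s 0 * (starRingEnd ℂ) z ^ s 1) := by
      simp [evp, MvPolynomial.eval_monomial, Finsupp.prod_fintype]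
    rw [this, wt]
    simp only [norm_mul, norm_pow, RCLike.norm_conj, Complex.norm_real, Real.norm_eq_abs, Real.abs_exp, pow_add]
    apply le_of_eq
    ring
  | add p q hp hq =>
    have h := hp.add hq
    refine h.congr (Filter.Eventually.of_forall fun z => ?_)
    simp [evp_add, add_mul]

noncomputable def Lf (n : ℕ) (p : MP) : ℂ := ∫ z : ℂ, evp p z * wt n z

lemma Lf_add (n : ℕ) (hn : 1 ≤ n) (p q : MP) : Lf n (p + q) = Lf n p + Lf n q := by
  simp only [Lf, evp_add, add_mul]
  exact integral_add (evp_integrable n hn p) (evp_integrable n hn q)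

lemma Lf_smul (n : ℕ) (a : ℂ) (p : MP) : Lf n (a • p) = a * Lf n p := by
  simp only [Lf, evp_smul, mul_assoc]
  exact integral_const_mul _ _

lemma Lf_parts (n : ℕ) (hn : 1 ≤ n) (p : MP) (v : ℂ) :
    (-(n : ℂ) * v) * Lf n (MvPolynomial.X 1 * p)
      + (-(n : ℂ) * (starRingEnd ℂ) v) * Lf n (MvPolynomial.X 0 * p)
    = -(v * Lf n (MvPolynomial.pderiv 0 p)
      + (starRingEnd ℂ) v * Lf n (MvPolynomial.pderiv 1 p)) := by
  have e1 : ∀ z, fderiv ℝ (evp p) z v * wt n z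
      = evp (v • MvPolynomial.pderiv 0 p + (starRingEnd ℂ) v • MvPolynomial.pderiv 1 p) z * wt n z := by
    intro z
    rw [(evp_hasFDerivAt p z).fderiv, cL_apply, evp_add, evp_smul, evp_smul]
    ring
  have e2 : ∀ z, evp p z * fderiv ℝ (wt n) z v
      = evp ((-(n : ℂ) * v) • (MvPolynomial.X 1 * p)
        + (-(n : ℂ) * (starRingEnd ℂ) v) • (MvPolynomial.X 0 * p)) z * wt n z := by
    intro z
    rw [(wt_hasFDerivAt n z).fderiv, cL_apply, evp_add, evp_smul, evp_smul, evp_mul, evp_mul,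
      evp_X0, evp_X1]
    ring
  have h := integral_mul_fderiv_eq_neg_fderiv_mul_of_integrable (μ := (volume : Measure ℂ))
    (f := evp p) (g := wt n) (v := v)
    (by simp only [e1]; exact evp_integrable n hn _)
    (by simp only [e2]; exact evp_integrable n hn _)
    (evp_integrable n hn _)
    (fun z _ => (evp_hasFDerivAt p z).differentiableAt)
    (fun z _ => (wt_hasFDerivAt n z).differentiableAt)
  simp only [e1, e2] at h
  change Lf n _ = - Lf n _ at h
  simpa only [Lf_add n hn, Lf_smul] using h

lemma Lf_TP (n : ℕ) (hn : 1 ≤ n) (p : MP) : Lf n (TP n p) = 0 := by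
  have h1 := Lf_parts n hn p 1
  have h2 := Lf_parts n hn p Complex.I
  have h3 : Lf n (TP n p) = (n : ℂ) * Lf n (MvPolynomial.X 1 * p) - Lf n (MvPolynomial.pderiv 0 p) := by
    have : TP n p = (n : ℂ) • (MvPolynomial.X 1 * p) + (-1 : ℂ) • MvPolynomial.pderiv 0 p := by
      rw [TP_apply]; simp [sub_eq_add_neg]
    rw [this, Lf_add n hn, Lf_smul, Lf_smul]
    ring
  rw [h3]
  simp only [map_one, Complex.conj_I] at h1 h2
  have hI : Complex.I * Complex.I = -1 := Complex.I_mul_I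
  linear_combination (-1/2 : ℂ) * h1 + (Complex.I / 2) * h2
    + (-1 : ℂ) / 2 * (-(n : ℂ) * Lf n (MvPolynomial.X 1 * p) + n * Lf n (MvPolynomial.X 0 * p)
      + Lf n (MvPolynomial.pderiv 0 p) - Lf n (MvPolynomial.pderiv 1 p)) * hI

noncomputable def sg : MP →+* MP :=
  MvPolynomial.eval₂Hom (MvPolynomial.C.comp (starRingEnd ℂ)) ![MvPolynomial.X 1, MvPolynomial.X 0]

lemma evp_sg (p : MP) (z : ℂ) : evp (sg p) z = (starRingEnd ℂ) (evp p z) := by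
  induction p using MvPolynomial.induction_on with
  | C a => simp [sg, evp]
  | add p q hp hq => simp only [map_add, evp_add, hp, hq]
  | mul_X p i hp =>
    simp only [map_mul, evp_mul, hp]
    congr 1
    fin_cases i <;> simp [sg, evp]

lemma pderiv_sg (p : MP) :
    MvPolynomial.pderiv 0 (sg p) = sg (MvPolynomial.pderiv 1 p) := by
  induction p using MvPolynomial.induction_on with
  | C a => simp [sg]
  | add p q hp hq => simp only [map_add, hp, hq]
  | mul_X p i hp =>
    simp only [map_mul, MvPolynomial.pderiv_mul, hp, map_add]
    congr 2
    fin_cases i <;> simp [sg]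

lemma fock_evp (n : ℕ) (p q : MP) : fockInner n (evp p) (evp q) = Lf n (p * sg q) / π := by
  simp only [fockInner, Lf, evp_mul, evp_sg, wt]

lemma fock_adj (n : ℕ) (hn : 1 ≤ n) (p q : MP) :
    fockInner n (evp (TP n p)) (evp q) = fockInner n (evp p) (evp (MvPolynomial.pderiv 1 q)) := by
  rw [fock_evp, fock_evp]
  have h : TP n p * sg q = TP n (p * sg q) + p * sg (MvPolynomial.pderiv 1 q) := by
    rw [TP_apply, TP_apply, MvPolynomial.pderiv_mul, pderiv_sg, sub_mul, smul_mul_assoc, mul_assoc]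
    ring
  rw [h, Lf_add n hn, Lf_TP n hn, zero_add]

lemma fock_conj (n : ℕ) (f g : ℂ → ℂ) : fockInner n f g = (starRingEnd ℂ) (fockInner n g f) := by
  rw [fockInner, fockInner, map_div₀, ← integral_conj]
  simp only [map_mul, Complex.conj_conj, Complex.conj_ofReal]
  congr 2
  ext z
  ring

lemma fock_zero (n : ℕ) (f : ℂ → ℂ) : fockInner n f (evp 0) = 0 := by
  simp [fockInner, evp]

lemma fock_scal (n : ℕ) (a b : ℂ) (f g : ℂ → ℂ) :
    fockInner n (fun z => a * f z) (fun z => b * g z)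
      = a * (starRingEnd ℂ) b * fockInner n f g := by
  rw [fockInner, fockInner, ← mul_div_assoc, ← integral_const_mul]
  simp only [map_mul]
  congr 2
  ext z
  ring

lemma pd_comm (p : MP) : MvPolynomial.pderiv 1 (MvPolynomial.pderiv 0 p)
    = MvPolynomial.pderiv 0 (MvPolynomial.pderiv 1 p) := by
  induction p using MvPolynomial.induction_on with
  | C a => simp
  | add p q hp hq => simp only [map_add, hp, hq]
  | mul_X p i hp =>
    fin_cases i <;> simp [hp] <;> ring

lemma pd_TP (n : ℕ) (p : MP) : MvPolynomial.pderiv 1 (TP n p)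
    = TP n (MvPolynomial.pderiv 1 p) + (n : ℂ) • p := by
  rw [TP_apply, TP_apply, map_sub, pd_comm, Derivation.map_smul, MvPolynomial.pderiv_mul]
  simp
  ring

lemma pd_iter (n : ℕ) (p : MP) (hp : MvPolynomial.pderiv 1 p = 0) (s : ℕ) :
    MvPolynomial.pderiv 1 ((TP n)^[s + 1] p) = ((s + 1 : ℂ) * n) • (TP n)^[s] p := by
  induction s with
  | zero => simp [pd_TP, hp]
  | succ s ih =>
    rw [Function.iterate_succ_apply', pd_TP, ih, map_smul, ← Function.iterate_succ_apply' (TP n), ← add_smul]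
    congr 1
    push_cast
    ring

lemma fock_smul_right (n : ℕ) (a : ℂ) (p q : MP) :
    fockInner n (evp p) (evp (a • q)) = (starRingEnd ℂ) a * fockInner n (evp p) (evp q) := by
  have h := fock_scal n 1 a (evp p) (evp q)
  simp only [one_mul] at h
  rw [← h]
  congr 1
  ext z
  simp [evp_smul]

lemma fock_iter (n : ℕ) (hn : 1 ≤ n) (p g : MP) (hp : MvPolynomial.pderiv 1 p = 0)
    (hg : MvPolynomial.pderiv 1 g = 0) (r s : ℕ) :
    fockInner n (evp ((TP n)^[r] p)) (evp ((TP n)^[s] g))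
      = if r = s then (n : ℂ) ^ r * r.factorial * fockInner n (evp p) (evp g) else 0 := by
  induction r generalizing s with
  | zero =>
    cases s with
    | zero => simp
    | succ s =>
      rw [fock_conj, Function.iterate_succ_apply', fock_adj n hn]
      simp [hp, fock_zero]
  | succ r ih =>
    rw [Function.iterate_succ_apply', fock_adj n hn]
    cases s with
    | zero => simp [hg, fock_zero]
    | succ s =>
      rw [pd_iter n g hg, fock_smul_right, ih]
      by_cases h : r = s
      · subst h
        simp [Nat.factorial_succ]
        ring
      · simp [h]

noncomputable def PolP (n q : ℕ) : Submodule ℂ MP :=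
  Submodule.span ℂ {f | ∃ j < n, ∃ r < q, f = MvPolynomial.X 1 ^ r * MvPolynomial.X 0 ^ j}

lemma evp_mon (r j : ℕ) : evp (MvPolynomial.X 1 ^ r * MvPolynomial.X 0 ^ j)
    = fun z => ((starRingEnd ℂ) z) ^ r * z ^ j := by
  ext z
  rw [evp_mul, evp_pow, evp_pow, evp_X0, evp_X1]

lemma Pol_eq (n q : ℕ) : Pol n q = (PolP n q).map evL := by
  rw [Pol, PolP, Submodule.map_span]
  congr 1
  ext f
  simp only [Set.mem_setOf_eq, Set.mem_image]
  constructor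
  · rintro ⟨j, hj, r, hr, rfl⟩
    exact ⟨_, ⟨j, hj, r, hr, rfl⟩, evp_mon r j⟩
  · rintro ⟨_, ⟨j, hj, r, hr, rfl⟩, rfl⟩
    exact ⟨j, hj, r, hr, evp_mon r j⟩

lemma PolP_pd {n : ℕ} {p : MP} (hp : p ∈ PolP n 1) : MvPolynomial.pderiv 1 p = 0 := by
  have : PolP n 1 ≤ LinearMap.ker (MvPolynomial.pderiv (R := ℂ) (1 : Fin 2)).toLinearMap := by
    rw [PolP, Submodule.span_le]
    rintro _ ⟨j, hj, r, hr, rfl⟩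
    obtain rfl : r = 0 := by omega
    simp [MvPolynomial.pderiv_pow]
  exact this hp

lemma PolP_mono {n q q' : ℕ} (h : q ≤ q') : PolP n q ≤ PolP n q' := by
  apply Submodule.span_mono
  rintro _ ⟨j, hj, r, hr, rfl⟩
  exact ⟨j, hj, r, hr.trans_le h, rfl⟩

lemma TP_mon (n r j : ℕ) : TP n (MvPolynomial.X 1 ^ r * MvPolynomial.X 0 ^ j)
    = (n : ℂ) • (MvPolynomial.X 1 ^ (r + 1) * MvPolynomial.X 0 ^ j)
      - (j : ℂ) • (MvPolynomial.X 1 ^ r * MvPolynomial.X 0 ^ (j - 1)) := by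
  rw [TP_apply]
  congr 1
  · rw [pow_succ]; congr 1; ring
  · simp [MvPolynomial.pderiv_mul, MvPolynomial.pderiv_pow, MvPolynomial.smul_eq_C_mul]
    ring

lemma mon_mem {n q r j : ℕ} (hj : j < n) (hr : r < q) :
    (MvPolynomial.X 1 ^ r * MvPolynomial.X 0 ^ j : MP) ∈ PolP n q :=
  Submodule.subset_span ⟨j, hj, r, hr, rfl⟩

lemma TP_mem {n q : ℕ} {p : MP} (hp : p ∈ PolP n q) : TP n p ∈ PolP n (q + 1) := by
  have : PolP n q ≤ (PolP n (q + 1)).comap (TP n) := by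
    conv_lhs => rw [PolP]
    rw [Submodule.span_le]
    rintro _ ⟨j, hj, r, hr, rfl⟩
    simp only [SetLike.mem_coe, Submodule.mem_comap, TP_mon]
    exact sub_mem (Submodule.smul_mem _ _ (mon_mem hj (by omega)))
      (Submodule.smul_mem _ _ (mon_mem (by omega) (by omega)))
  exact this hp

lemma TP_iter_mem {n q : ℕ} {p : MP} (hp : p ∈ PolP n q) (r : ℕ) :
    (TP n)^[r] p ∈ PolP n (q + r) := by
  induction r with
  | zero => exact hp
  | succ r ih => rw [Function.iterate_succ_apply']; exact TP_mem ih

lemma TP_lead {n j : ℕ} (hj : j < n) (r : ℕ) :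
    (TP n)^[r] (MvPolynomial.X 0 ^ j)
      - ((n : ℂ) ^ r) • (MvPolynomial.X 1 ^ r * MvPolynomial.X 0 ^ j) ∈ PolP n r := by
  induction r with
  | zero => simp
  | succ r ih =>
    have h1 := TP_mem ih
    rw [map_sub, map_smul, TP_mon, ← Function.iterate_succ_apply' (TP n)] at h1
    have h2 : ((n : ℂ) ^ r * (j : ℂ)) • (MvPolynomial.X 1 ^ r * MvPolynomial.X 0 ^ (j - 1) : MP)
      ∈ PolP n (r + 1) := Submodule.smul_mem _ _ (mon_mem (by omega) (by omega))
    have h3 := sub_mem h1 h2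
    convert h3 using 1
    rw [smul_sub, smul_smul, smul_smul, pow_succ (n : ℂ)]
    abel

lemma iter_add (n r : ℕ) (p q : MP) : (TP n)^[r] (p + q) = (TP n)^[r] p + (TP n)^[r] q := by
  rw [← Module.End.coe_pow, map_add]

lemma iter_smul (n r : ℕ) (a : ℂ) (p : MP) : (TP n)^[r] (a • p) = a • (TP n)^[r] p := by
  rw [← Module.End.coe_pow, map_smul]

theorem raising_operator_onb (n q : ℕ) (hn : 1 ≤ n) (hq : 1 ≤ q)
    (e : Fin n → ℂ → ℂ)
    (he_mem : ∀ j, e j ∈ Pol n 1)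
    (he_span : Submodule.span ℂ (Set.range e) = Pol n 1)
    (he_on : ∀ i j, fockInner n (e i) (e j) = if i = j then 1 else 0) :
    (∀ r r' : Fin q, ∀ j j' : Fin n,
        fockInner n
          (fun z => ((Real.sqrt ((n : ℝ) ^ (r : ℕ) * ((r : ℕ).factorial)) : ℂ))⁻¹ *
            (Tn (n : ℝ))^[(r : ℕ)] (e j) z)
          (fun z => ((Real.sqrt ((n : ℝ) ^ (r' : ℕ) * ((r' : ℕ).factorial)) : ℂ))⁻¹ *
            (Tn (n : ℝ))^[(r' : ℕ)] (e j') z)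
          = if (r, j) = (r', j') then 1 else 0) ∧
    Submodule.span ℂ
        {h : ℂ → ℂ | ∃ r : Fin q, ∃ j : Fin n,
          h = fun z => ((Real.sqrt ((n : ℝ) ^ (r : ℕ) * ((r : ℕ).factorial)) : ℂ))⁻¹ *
            (Tn (n : ℝ))^[(r : ℕ)] (e j) z}
      = Pol n q := by
  have hp : ∀ j, ∃ p ∈ PolP n 1, evp p = e j := by
    intro j
    have h := he_mem j
    rw [Pol_eq, Submodule.mem_map] at h
    exact h
  choose p hpm hpe using hp
  have hn0 : (0 : ℝ) < n := by exact_mod_cast hn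
  have hc : ∀ r : ℕ, (0 : ℝ) < Real.sqrt ((n : ℝ) ^ r * (r.factorial)) := by
    intro r
    apply Real.sqrt_pos.2
    positivity
  have hc0 : ∀ r : ℕ, ((Real.sqrt ((n : ℝ) ^ r * (r.factorial)) : ℝ) : ℂ) ≠ 0 := by
    intro r
    exact_mod_cast (hc r).ne'
  constructor
  · intro r r' j j'
    rw [fock_scal, ← hpe j, ← hpe j', Tn_iter, Tn_iter,
      fock_iter n hn _ _ (PolP_pd (hpm j)) (PolP_pd (hpm j')), hpe, hpe, he_on]
    by_cases hr : r = r'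
    · subst hr
      have hs : ((Real.sqrt ((n : ℝ) ^ (r : ℕ) * ((r : ℕ).factorial)) : ℝ) : ℂ)
          * ((Real.sqrt ((n : ℝ) ^ (r : ℕ) * ((r : ℕ).factorial)) : ℝ) : ℂ)
          = (n : ℂ) ^ (r : ℕ) * ((r : ℕ).factorial) := by
        rw [← Complex.ofReal_mul, Real.mul_self_sqrt (by positivity)]
        push_cast
        rfl
      have h0 := hc0 r
      by_cases hj : j = j'
      · subst hj
        simp only [if_true, map_inv₀, Complex.conj_ofReal, mul_one]
        rw [← hs]
        field_simp
      · simp [hj]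
    · have : (r : ℕ) ≠ (r' : ℕ) := fun h => hr (Fin.ext h)
      simp [hr, this]
  · set S := Submodule.span ℂ
        {h : ℂ → ℂ | ∃ r : Fin q, ∃ j : Fin n,
          h = fun z => ((Real.sqrt ((n : ℝ) ^ (r : ℕ) * ((r : ℕ).factorial)) : ℂ))⁻¹ *
            (Tn (n : ℝ))^[(r : ℕ)] (e j) z} with hS
    apply le_antisymm
    · rw [hS, Submodule.span_le]
      rintro _ ⟨r, j, rfl⟩
      rw [← hpe j, Tn_iter, Pol_eq]
      refine Submodule.smul_mem _ (_ : ℂ)⁻¹ (Submodule.mem_map_of_mem (f := evL) ?_)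
      exact PolP_mono (by omega) (TP_iter_mem (hpm j) r)
    · have key1 : ∀ r < q, ∀ j, (Tn (n : ℝ))^[r] (e j) ∈ S := by
        intro r hr j
        have h : (fun z => ((Real.sqrt ((n : ℝ) ^ r * (r.factorial)) : ℂ))⁻¹ *
            (Tn (n : ℝ))^[r] (e j) z) ∈ S := Submodule.subset_span ⟨⟨r, hr⟩, j, rfl⟩
        have h2 := Submodule.smul_mem S ((Real.sqrt ((n : ℝ) ^ r * (r.factorial)) : ℝ) : ℂ) h
        convert h2 using 1
        ext z
        simp only [Pi.smul_apply, smul_eq_mul]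
        rw [mul_inv_cancel_left₀ (hc0 r)]
      have key2 : ∀ r < q, ∀ f ∈ Pol n 1, (Tn (n : ℝ))^[r] f ∈ S := by
        intro r hr f hf
        have aux : ∃ g : MP, evp g = f ∧ (evp ((TP n)^[r] g)) ∈ S := by
          rw [← he_span] at hf
          induction hf using Submodule.span_induction with
          | mem x hx =>
            obtain ⟨j, rfl⟩ := hx
            refine ⟨p j, hpe j, ?_⟩
            rw [← Tn_iter, hpe]
            exact key1 r hr j
          | zero =>
            refine ⟨0, by ext z; simp [evp], ?_⟩
            rw [← Module.End.coe_pow, map_zero]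
            have : evp 0 = 0 := by ext z; simp [evp]
            rw [this]
            exact zero_mem _
          | add x y _ _ hx hy =>
            obtain ⟨g, rfl, hg⟩ := hx
            obtain ⟨k, rfl, hk⟩ := hy
            refine ⟨g + k, evL.map_add g k, ?_⟩
            rw [iter_add]
            have := add_mem hg hk
            exact Eq.mp (congrArg (· ∈ S) (evL.map_add ((TP n)^[r] g) ((TP n)^[r] k)).symm) this
          | smul a x _ hx =>
            obtain ⟨g, rfl, hg⟩ := hx
            refine ⟨a • g, evL.map_smul a g, ?_⟩
            rw [iter_smul]
            have := S.smul_mem a hg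
            exact Eq.mp (congrArg (· ∈ S) (evL.map_smul a ((TP n)^[r] g)).symm) this
        obtain ⟨g, rfl, hg⟩ := aux
        rwa [Tn_iter]
      have key3 : ∀ r ≤ q, Pol n r ≤ S := by
        intro r
        induction r with
        | zero =>
          intro _
          rw [Pol, Submodule.span_le]
          rintro _ ⟨j, hj, r, hr, rfl⟩
          omega
        | succ r ih =>
          intro hr
          have ih := ih (by omega)
          rw [Pol, Submodule.span_le]
          rintro _ ⟨j, hj, s, hs, rfl⟩
          by_cases hsr : s < r
          · exact ih (Submodule.subset_span ⟨j, hj, s, hsr, rfl⟩)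
          obtain rfl : s = r := by omega
          have h1 : evp (_ - _) ∈ S := ih (by
            rw [Pol_eq]; exact Submodule.mem_map_of_mem (f := evL) (TP_lead hj s))
          have h2 : evp ((TP n)^[s] (MvPolynomial.X 0 ^ j)) ∈ S := by
            rw [← Tn_iter]
            apply key2 s (by omega)
            refine Submodule.subset_span ⟨j, hj, 0, by omega, ?_⟩
            rw [← evp_mon]; simp
          have h3 := S.smul_mem (((n : ℂ) ^ s)⁻¹) (sub_mem h2 h1)
          rw [← evp_mon]
          refine Eq.mp (congrArg (· ∈ S) ?_) h3
          symm
          have hnc : (n : ℂ) ^ s ≠ 0 := pow_ne_zero _ (by exact_mod_cast hn0.ne')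
          ext z
          simp only [Pi.smul_apply, Pi.sub_apply, smul_eq_mul, evp_sub, evp_smul]
          rw [sub_sub_cancel, inv_mul_cancel_left₀ hnc]
      exact key3 q le_rfl
end

section
/- For analytic polynomials p, q of degree < n and integers 0 ≤ r < s, the functions T_n^r p and T_n^s q are orthogonal in L^2(e^{-n|z|^2}dA): ∫_ℂ T_n^r p(z) \overline{T_n^s q(z)} e^{-n|z|^2} dA(z) = 0. Moreover, ∫_ℂ T_n^r p(z) \overline{T_n^r q(z)} e^{-n|z|^2} dA(z) = n^r r! ∫_ℂ p(z)\overline{q(z)} e^{-n|z|^2} dA(z). -/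
open MeasureTheory

namespace RaisingAux
open MvPolynomial

/-- Polynomials in `z` (index `false`) and `z̄` (index `true`). -/
abbrev PP := MvPolynomial Bool ℂ

/-- Point of evaluation. -/
noncomputable def pt (z : ℂ) : Bool → ℂ := fun b => if b then (starRingEnd ℂ) z else z

/-- Evaluation. -/
noncomputable def ev (P : PP) (z : ℂ) : ℂ := MvPolynomial.eval (pt z) P

/-- Conjugation of polynomials. -/
noncomputable def st : PP →+* PP :=
  MvPolynomial.eval₂Hom (MvPolynomial.C.comp (starRingEnd ℂ)) (fun b => X (!b))

lemma ev_st (P : PP) (z : ℂ) : ev (st P) z = (starRingEnd ℂ) (ev P z) := by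
  unfold ev
  induction P using MvPolynomial.induction_on with
  | C a => simp [st]
  | add p q hp hq => simp [hp, hq]
  | mul_X p b hp => rw [map_mul, map_mul, hp]; cases b <;> simp [st, pt]

lemma pd_st (P : PP) : pderiv true (st P) = st (pderiv false P) := by
  induction P using MvPolynomial.induction_on with
  | C a => simp [st]
  | add p q hp hq => simp [hp, hq]
  | mul_X p b hp =>
    rw [map_mul, pderiv_mul, pderiv_mul, hp]
    cases b <;> simp [st, pderiv_X, Pi.single_apply]

lemma ev_hasFDerivAt (P : PP) (z : ℂ) : HasFDerivAt (ev P)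
    (ev (pderiv false P) z • (ContinuousLinearMap.id ℝ ℂ) +
      ev (pderiv true P) z • (Complex.conjCLE : ℂ →L[ℝ] ℂ)) z := by
  induction P using MvPolynomial.induction_on with
  | C a =>
    have : ev (C a) = fun _ => a := by funext z; simp [ev]
    rw [this]
    refine (hasFDerivAt_const a z).congr_fderiv ?_
    ext <;> simp [ev]
  | add p q hp hq =>
    have : ev (p + q) = fun w => ev p w + ev q w := by funext z; simp [ev]
    rw [this]
    refine (hp.add hq).congr_fderiv ?_
    apply ContinuousLinearMap.ext; intro v
    simp [ev]; ring
  | mul_X p b hp =>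
    cases b
    · have : ev (p * X false) = fun w => ev p w * w := by funext z; simp [ev, pt]
      rw [this]
      refine (hp.mul (hasFDerivAt_id z)).congr_fderiv ?_
      apply ContinuousLinearMap.ext; intro v
      simp [ev, pderiv_mul, pderiv_X, Pi.single_apply, pt]; ring
    · have : ev (p * X true) = fun w => ev p w * Complex.conjCLE w := by
        funext z; simp [ev, pt]
      rw [this]
      refine (hp.mul (Complex.conjCLE : ℂ →L[ℝ] ℂ).hasFDerivAt).congr_fderiv ?_
      apply ContinuousLinearMap.ext; intro v
      simp [ev, pderiv_mul, pderiv_X, Pi.single_apply, pt]; ring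

lemma ev_continuous (P : PP) : Continuous (ev P) :=
  continuous_iff_continuousAt.2 fun z => (ev_hasFDerivAt P z).continuousAt

lemma wD_ev (P : PP) : wD (ev P) = ev (pderiv false P) := by
  funext z
  rw [wD, (ev_hasFDerivAt P z).fderiv]
  simp
  linear_combination (1/2 * (ev (pderiv true P) z - ev (pderiv false P) z)) * Complex.I_mul_I

/-- Raising operator on polynomials. -/
noncomputable def T (n : ℕ) (P : PP) : PP := C (n : ℂ) * X true * P - pderiv false P

lemma Tn_ev (n : ℕ) (P : PP) : Tn (n : ℝ) (ev P) = ev (T n P) := by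
  funext z
  rw [Tn, wD_ev]
  simp [T, ev, pt]

lemma Tn_iter (n : ℕ) (P : PP) (r : ℕ) : (Tn (n : ℝ))^[r] (ev P) = ev ((T n)^[r] P) := by
  induction r generalizing P with
  | zero => rfl
  | succ r ih => rw [Function.iterate_succ_apply, Function.iterate_succ_apply, Tn_ev, ih]

/-- Gaussian weight. -/
noncomputable def G (n : ℕ) (z : ℂ) : ℂ := (Real.exp (-(n : ℝ) * ‖z‖ ^ 2) : ℂ)

lemma G_eq (n : ℕ) (z : ℂ) : G n z = Complex.exp (-(n : ℂ) * (z * Complex.conjCLE z)) := by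
  have : z * Complex.conjCLE z = ((‖z‖ ^ 2 : ℝ) : ℂ) := by
    rw [Complex.conjCLE_apply, Complex.mul_conj, Complex.normSq_eq_norm_sq]
  rw [this, G]; push_cast; rfl

lemma G_hasFDerivAt (n : ℕ) (z : ℂ) : HasFDerivAt (G n)
    ((-(n : ℂ) * G n z) • ((starRingEnd ℂ z) • (ContinuousLinearMap.id ℝ ℂ) +
      z • (Complex.conjCLE : ℂ →L[ℝ] ℂ))) z := by
  have h := ((((hasFDerivAt_id (𝕜 := ℝ) z).mul
    (Complex.conjCLE : ℂ →L[ℝ] ℂ).hasFDerivAt).const_mul (-(n : ℂ))).cexp)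
  have e : G n = fun z => Complex.exp (-(n : ℂ) * (z * Complex.conjCLE z)) := funext (G_eq n)
  rw [e]
  refine h.congr_fderiv ?_
  apply ContinuousLinearMap.ext; intro v
  simp; ring

lemma G_continuous (n : ℕ) : Continuous (G n) :=
  continuous_iff_continuousAt.2 fun z => (G_hasFDerivAt n z).continuousAt

lemma int_pow (n : ℕ) (hn : 1 ≤ n) (k : ℕ) :
    Integrable (fun z : ℂ => ((‖z‖ ^ k * Real.exp (-(n : ℝ) * ‖z‖ ^ 2) : ℝ) : ℂ)) := by
  have hn' : (0:ℝ) < n := by exact_mod_cast hn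
  suffices hh : Integrable (fun z : ℂ => ‖z‖ ^ k * Real.exp (-(n : ℝ) * ‖z‖ ^ 2)) from hh.ofReal
  by_contra hc
  have h0 := integral_undef hc
  have hk : (0:ℝ) ≤ k := Nat.cast_nonneg k
  have h := Complex.integral_rpow_mul_exp_neg_mul_rpow (p := 2) (q := k) (b := n) (by norm_num)
    (by linarith) hn'
  simp only [Real.rpow_natCast, Real.rpow_ofNat] at h
  rw [h0] at h
  have : 0 < Real.Gamma (((k:ℝ) + 2) / 2) := Real.Gamma_pos_of_pos (by positivity)
  have : 0 < (2 * Real.pi / 2) * (n:ℝ) ^ (-((k:ℝ) + 2) / 2) * Real.Gamma (((k:ℝ) + 2) / 2) := by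
    positivity
  linarith

lemma int_aux (n : ℕ) (hn : 1 ≤ n) (P : PP) : ∀ k : ℕ,
    Integrable (fun z : ℂ => (‖z‖ : ℂ) ^ k * (ev P z * G n z)) := by
  induction P using MvPolynomial.induction_on with
  | C a =>
    intro k
    refine ((int_pow n hn k).const_mul a).congr (Filter.Eventually.of_forall fun z => ?_)
    simp [ev, G]; ring
  | add p q hp hq =>
    intro k
    refine ((hp k).add (hq k)).congr (Filter.Eventually.of_forall fun z => ?_)
    simp [ev]; ring
  | mul_X p b hp =>
    intro k
    refine (hp (k+1)).mono ?_ (Filter.Eventually.of_forall fun z => ?_)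
    · apply Continuous.aestronglyMeasurable
      have := ev_continuous (p * X b)
      have := G_continuous n
      fun_prop
    · have : ‖pt z b‖ = ‖z‖ := by cases b <;> simp [pt]
      simp only [ev, map_mul, eval_X, norm_mul, this, norm_pow, Complex.norm_real, norm_norm]
      apply le_of_eq; ring

lemma int_ev (n : ℕ) (hn : 1 ≤ n) (P : PP) : Integrable (fun z : ℂ => ev P z * G n z) := by
  simpa using int_aux n hn P 0

/-- Gaussian functional. -/
noncomputable def L (n : ℕ) (P : PP) : ℂ := ∫ z : ℂ, ev P z * G n z

lemma L_add (n : ℕ) (hn : 1 ≤ n) (P Q : PP) : L n (P + Q) = L n P + L n Q := by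
  rw [L, L, L, ← integral_add (int_ev n hn P) (int_ev n hn Q)]
  congr 1; funext z; simp [ev, add_mul]

lemma L_C (n : ℕ) (a : ℂ) (P : PP) : L n (C a * P) = a * L n P := by
  rw [L, L, ← integral_const_mul]
  congr 1; funext z; simp [ev, mul_assoc]

lemma L_ibp (n : ℕ) (hn : 1 ≤ n) (F : PP) (v : ℂ) :
    L n (C (-(n : ℂ) * v) * (X true * F) + C (-(n : ℂ) * starRingEnd ℂ v) * (X false * F)) =
    - L n (C v * pderiv false F + C (starRingEnd ℂ v) * pderiv true F) := by
  have e1 : ∀ z, ev F z * fderiv ℝ (G n) z v = ev (C (-(n : ℂ) * v) * (X true * F) +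
      C (-(n : ℂ) * starRingEnd ℂ v) * (X false * F)) z * G n z := by
    intro z
    rw [(G_hasFDerivAt n z).fderiv]
    simp [ev, pt]; ring
  have e2 : ∀ z, fderiv ℝ (ev F) z v * G n z = ev (C v * pderiv false F +
      C (starRingEnd ℂ v) * pderiv true F) z * G n z := by
    intro z
    rw [(ev_hasFDerivAt F z).fderiv]
    simp [ev, mul_comm]
  have h := integral_mul_fderiv_eq_neg_fderiv_mul_of_integrable (μ := (volume : Measure ℂ))
    (f := ev F) (g := G n) (v := v)
    (by simp only [e2]; exact int_ev n hn _) (by simp only [e1]; exact int_ev n hn _)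
    (int_ev n hn F) (fun z _ => (ev_hasFDerivAt F z).differentiableAt)
    (fun z _ => (G_hasFDerivAt n z).differentiableAt)
  simp only [e1, e2] at h
  exact h

lemma L_dbar (n : ℕ) (hn : 1 ≤ n) (F : PP) :
    L n (pderiv true F) = n * L n (X false * F) := by
  have h1 := L_ibp n hn F 1
  have h2 := L_ibp n hn F Complex.I
  simp only [L_add n hn, L_C, map_one, one_mul, Complex.conj_I] at h1 h2
  linear_combination (1/2) * h1 + (1/2) * Complex.I * h2 + (1/2) * (n * L n (X true * F) - n * L n (X false * F) - L n (pderiv false F) + L n (pderiv true F)) * Complex.I_mul_I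

/-- Sesquilinear form. -/
noncomputable def A (n : ℕ) (P Q : PP) : ℂ := L n (P * st Q)

lemma A_adj (n : ℕ) (hn : 1 ≤ n) (P Q : PP) : A n P (T n Q) = A n (pderiv true P) Q := by
  have h := L_dbar n hn (P * st Q)
  rw [pderiv_mul, L_add n hn, pd_st] at h
  have e : P * st (T n Q) = C (n : ℂ) * (X false * (P * st Q)) + C (-1) * (P * st (pderiv false Q)) := by
    have : st (T n Q) = C (n : ℂ) * X false * st Q - st (pderiv false Q) := by
      simp only [T, map_sub, map_mul]
      simp [st]
    rw [this]; simp; ring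
  rw [A, e, L_add n hn, L_C, L_C, A]
  linear_combination -h

lemma pd_comm (P : PP) : pderiv true (pderiv false P) = pderiv false (pderiv true P) := by
  induction P using MvPolynomial.induction_on with
  | C a => simp
  | add p q hp hq => simp [hp, hq]
  | mul_X p b hp =>
    cases b <;> simp [hp, pderiv_X, add_comm]

lemma pd_T (n : ℕ) (P : PP) : pderiv true (T n P) = C (n : ℂ) * P + T n (pderiv true P) := by
  simp only [T, map_sub, pd_comm, pderiv_mul, pderiv_C, pderiv_X_self]
  ring

lemma T_C (n : ℕ) (a : ℂ) (P : PP) : T n (C a * P) = C a * T n P := by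
  simp only [T, pderiv_C_mul]; ring

lemma pd_T_iter (n : ℕ) (P : PP) (hP : pderiv true P = 0) (r : ℕ) :
    pderiv true ((T n)^[r+1] P) = C (((r:ℂ) + 1) * n) * (T n)^[r] P := by
  induction r with
  | zero => simp [pd_T, hP]; simp [T]
  | succ r ih =>
    rw [Function.iterate_succ_apply', pd_T, ih, T_C, ← Function.iterate_succ_apply' (T n)]
    push_cast
    simp only [map_add, map_mul, map_one]; ring

lemma A_C (n : ℕ) (a : ℂ) (P Q : PP) : A n (C a * P) Q = a * A n P Q := by
  rw [A, mul_assoc, L_C, A]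

lemma A_step (n : ℕ) (hn : 1 ≤ n) (P Q : PP) (hP : pderiv true P = 0) (r s : ℕ) :
    A n ((T n)^[r+1] P) ((T n)^[s+1] Q) = (((r:ℂ) + 1) * n) * A n ((T n)^[r] P) ((T n)^[s] Q) := by
  rw [Function.iterate_succ_apply' (T n) s, A_adj n hn, pd_T_iter n P hP, A_C]

lemma A_zero (n : ℕ) (hn : 1 ≤ n) (P Q : PP) (hP : pderiv true P = 0) (r s : ℕ) (h : r < s) :
    A n ((T n)^[r] P) ((T n)^[s] Q) = 0 := by
  induction r generalizing s with
  | zero =>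
    obtain ⟨s, rfl⟩ : ∃ t, s = t + 1 := ⟨s - 1, by omega⟩
    rw [Function.iterate_succ_apply' (T n) s, A_adj n hn]
    simp [hP, A, L, ev]
  | succ r ih =>
    obtain ⟨s, rfl⟩ : ∃ t, s = t + 1 := ⟨s - 1, by omega⟩
    rw [A_step n hn P Q hP, ih s (by omega), mul_zero]

lemma A_diag (n : ℕ) (hn : 1 ≤ n) (P Q : PP) (hP : pderiv true P = 0) (r : ℕ) :
    A n ((T n)^[r] P) ((T n)^[r] Q) = (n : ℂ) ^ r * (r.factorial : ℂ) * A n P Q := by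
  induction r with
  | zero => simp
  | succ r ih =>
    rw [A_step n hn P Q hP, ih, Nat.factorial_succ]; push_cast; ring

/-- Embedding of analytic polynomials. -/
noncomputable def em (p : Polynomial ℂ) : PP := Polynomial.aeval (X false) p

lemma ev_em (p : Polynomial ℂ) : ev (em p) = fun z => p.eval z := by
  funext z
  induction p using Polynomial.induction_on' with
  | add p q hp hq => simp only [ev, em, map_add, Polynomial.eval_add] at *; rw [hp, hq]
  | monomial k a => simp [ev, em, Polynomial.aeval_monomial, pt, algebraMap_eq]

lemma pd_em (p : Polynomial ℂ) : pderiv true (em p) = 0 := by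
  induction p using Polynomial.induction_on' with
  | add p q hp hq => simp only [em, map_add] at *; rw [hp, hq, add_zero]
  | monomial k a =>
    simp [em, Polynomial.aeval_monomial, algebraMap_eq, pderiv_pow, pderiv_X, Pi.single_apply]

lemma A_eq (n : ℕ) (P Q : PP) : A n P Q = ∫ z : ℂ, ev P z * (starRingEnd ℂ) (ev Q z) *
    (Real.exp (-(n : ℝ) * ‖z‖ ^ 2) : ℂ) := by
  rw [A, L]
  congr 1; funext z
  rw [← ev_st, G]; simp [ev]

end RaisingAux

theorem raising_operator_orthogonality (n : ℕ) (hn : 1 ≤ n)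
    (p q : Polynomial ℂ) (hp : p.degree < n) (hq : q.degree < n) (r s : ℕ) :
    (r < s →
      ∫ z : ℂ, (Tn (n : ℝ))^[r] (fun w => p.eval w) z *
          (starRingEnd ℂ) ((Tn (n : ℝ))^[s] (fun w => q.eval w) z) *
          (Real.exp (-(n : ℝ) * ‖z‖ ^ 2) : ℂ) = 0) ∧
    (∫ z : ℂ, (Tn (n : ℝ))^[r] (fun w => p.eval w) z *
          (starRingEnd ℂ) ((Tn (n : ℝ))^[r] (fun w => q.eval w) z) *
          (Real.exp (-(n : ℝ) * ‖z‖ ^ 2) : ℂ)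
      = (n : ℂ) ^ r * (r.factorial : ℂ) *
          ∫ z : ℂ, p.eval z * (starRingEnd ℂ) (q.eval z) *
            (Real.exp (-(n : ℝ) * ‖z‖ ^ 2) : ℂ)) := by
  have hP := RaisingAux.pd_em p
  rw [← RaisingAux.ev_em p, ← RaisingAux.ev_em q, RaisingAux.Tn_iter, RaisingAux.Tn_iter,
    RaisingAux.Tn_iter, ← RaisingAux.A_eq, ← RaisingAux.A_eq]
  refine ⟨fun h => RaisingAux.A_zero n hn _ _ hP r s h, ?_⟩
  rw [RaisingAux.A_diag n hn _ _ hP, RaisingAux.A_eq, RaisingAux.ev_em, RaisingAux.ev_em]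
end
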